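/- Every plane 3-tree G with positive vertex weights w admits a proportional box-contact representation: an assignment of pairwise interior-disjoint axis-aligned boxes in ℝ³ to the vertices such that the box of each vertex v has volume w(v), and two boxes share a boundary piece of non-zero area if and only if the corresponding vertices are adjacent in G. -/

import Mathlib

/-- A (straight-line) planar drawing of `G`: vertices are mapped injectively to the
plane and two edges meet only in shared endpoints.  By Fáry's theorem a graph is
planar iff it admits such a drawing. -/
def IsPlanarDrawing {V : Type} (G : SimpleGraph V) (pos : V → ℝ × ℝ) : Prop :=
  Function.Injective pos ∧
  ∀ u v x y : V, G.Adj u v → G.Adj x y → s(u, v) ≠ s(x, y) →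
    segment ℝ (pos u) (pos v) ∩ segment ℝ (pos x) (pos y) ⊆
      ({pos u, pos v} ∩ {pos x, pos y} : Set (ℝ × ℝ))

/-- A graph is planar iff it has a straight-line planar drawing. -/
def IsPlanar {V : Type} (G : SimpleGraph V) : Prop := ∃ pos, IsPlanarDrawing G pos

/-- 3-trees, by the recursive definition: a triangle is a 3-tree, and a graph with a
vertex `v` of degree three whose neighbours form a triangle and whose deletion
leaves a 3-tree is a 3-tree. -/
def IsThreeTree {V : Type} [Fintype V] [DecidableEq V] (G : SimpleGraph V) : Prop :=
  (Fintype.card V = 3 ∧ ∀ u v : V, u ≠ v → G.Adj u v) ∨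
  ∃ v : V, (G.neighborSet v).ncard = 3 ∧
    (∀ a ∈ G.neighborSet v, ∀ b ∈ G.neighborSet v, a ≠ b → G.Adj a b) ∧
    IsThreeTree (G.induce {u : V | u ≠ v})
termination_by Fintype.card V
decreasing_by
  exact Fintype.card_subtype_lt (x := v) (by simp)

/-- An axis-aligned box in ℝ³. -/
structure Box where
  lo : Fin 3 → ℝ
  hi : Fin 3 → ℝ
  lo_lt_hi : ∀ i, lo i < hi i

def Box.toSet (B : Box) : Set (Fin 3 → ℝ) := {p | ∀ i, B.lo i ≤ p i ∧ p i ≤ B.hi i}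

def Box.interior (B : Box) : Set (Fin 3 → ℝ) := {p | ∀ i, B.lo i < p i ∧ p i < B.hi i}

noncomputable def Box.volume (B : Box) : ℝ := ∏ i, (B.hi i - B.lo i)

def Box.IsCube (B : Box) : Prop := ∀ i j, B.hi i - B.lo i = B.hi j - B.lo j

/-- Two boxes are in proper contact if they share a piece of boundary of non-zero
area: they touch along some coordinate direction and overlap with positive extent
in the two remaining directions. -/
def Box.Contact (B C : Box) : Prop :=
  ∃ i : Fin 3, (B.hi i = C.lo i ∨ C.hi i = B.lo i) ∧
    ∀ j, j ≠ i → max (B.lo j) (C.lo j) < min (B.hi j) (C.hi j)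

/-- Sign analysis of barycentric coordinates. -/
lemma sign_class (X : Fin 3 → ℝ) (hs : X 0 + X 1 + X 2 = 1)
    (h : ∀ p q r : Fin 3, p ≠ q → p ≠ r → q ≠ r → X p ≤ 0 → 0 ≤ X q → 0 ≤ X r → False) :
    (∀ i, 0 < X i) ∨ ∃ p q r : Fin 3, p ≠ q ∧ p ≠ r ∧ q ≠ r ∧ 0 < X p ∧ X q < 0 ∧ X r < 0 := by
  have h0 := h 0 1 2 (by decide) (by decide) (by decide)
  have h1 := h 1 0 2 (by decide) (by decide) (by decide)
  have h2 := h 2 0 1 (by decide) (by decide) (by decide)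
  rcases lt_trichotomy (X 0) 0 with a | a | a <;> rcases lt_trichotomy (X 1) 0 with b | b | b <;>
    rcases lt_trichotomy (X 2) 0 with c | c | c <;>
    first
    | (exfalso; linarith)
    | (exfalso; exact h0 (by linarith) (by linarith) (by linarith))
    | (exfalso; exact h1 (by linarith) (by linarith) (by linarith))
    | (exfalso; exact h2 (by linarith) (by linarith) (by linarith))
    | (left; intro i; fin_cases i <;> assumption)
    | exact Or.inr ⟨0, 1, 2, by decide, by decide, by decide, a, b, c⟩
    | exact Or.inr ⟨1, 0, 2, by decide, by decide, by decide, b, a, c⟩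
    | exact Or.inr ⟨2, 0, 1, by decide, by decide, by decide, c, a, b⟩

/-- The abstract no-crossing hypothesis on barycentric coordinates. -/
def NoCross (X Y : Fin 3 → ℝ) : Prop :=
  ∀ p q r : Fin 3, p ≠ q → p ≠ r → q ≠ r → ∀ k : ℝ, 0 < k → Y q = k * X q →
    Y r ≤ k * X r → k * X p ≤ Y p → False

lemma noCross_pos (X Y : Fin 3 → ℝ) (h : NoCross X Y) (hX : ∀ i, 0 < X i) (hY : ∀ i, 0 < Y i) :
    False := by
  obtain ⟨k, hk⟩ : ∃ k : Fin 3 → ℝ, ∀ i, 0 < k i ∧ Y i = k i * X i :=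
    ⟨fun i => Y i / X i, fun i => ⟨div_pos (hY i) (hX i), by field_simp [(hX i).ne']⟩⟩
  have key : ∀ p q r : Fin 3, p ≠ q → p ≠ r → q ≠ r → k r ≤ k q → k q ≤ k p → False := by
    intro p q r h1 h2 h3 h4 h5
    refine h p q r h1 h2 h3 (k q) (hk q).1 (hk q).2 ?_ ?_
    · rw [(hk r).2]; exact mul_le_mul_of_nonneg_right h4 (hX r).le
    · rw [(hk p).2]; exact mul_le_mul_of_nonneg_right h5 (hX p).le
  rcases le_total (k 0) (k 1) with a | a <;> rcases le_total (k 1) (k 2) with b | b <;>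
    rcases le_total (k 0) (k 2) with c | c
  · exact key 2 1 0 (by decide) (by decide) (by decide) a b
  · exact key 2 1 0 (by decide) (by decide) (by decide) a b
  · exact key 1 2 0 (by decide) (by decide) (by decide) c b
  · exact key 1 0 2 (by decide) (by decide) (by decide) c a
  · exact key 2 0 1 (by decide) (by decide) (by decide) a c
  · exact key 0 2 1 (by decide) (by decide) (by decide) b c
  · exact key 0 1 2 (by decide) (by decide) (by decide) b a
  · exact key 0 1 2 (by decide) (by decide) (by decide) b a

lemma noCross_same (X Y : Fin 3 → ℝ) (h : NoCross X Y) (p q r : Fin 3)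
    (h1 : p ≠ q) (h2 : p ≠ r) (h3 : q ≠ r)
    (xp : 0 < X p) (xq : X q < 0) (xr : X r < 0) (yp : 0 < Y p) (yq : Y q < 0) (yr : Y r < 0) :
    False := by
  obtain ⟨a, ha, ea⟩ : ∃ k, 0 < k ∧ Y p = k * X p :=
    ⟨Y p / X p, div_pos yp xp, by field_simp [xp.ne']⟩
  obtain ⟨b, hb, eb⟩ : ∃ k, 0 < k ∧ Y q = k * X q :=
    ⟨Y q / X q, div_pos_of_neg_of_neg yq xq, by field_simp [xq.ne]⟩
  obtain ⟨c, hc, ec⟩ : ∃ k, 0 < k ∧ Y r = k * X r :=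
    ⟨Y r / X r, div_pos_of_neg_of_neg yr xr, by field_simp [xr.ne]⟩
  rcases le_total b c with hbc | hbc
  · rcases le_total b a with hba | hba
    · exact h p q r h1 h2 h3 b hb eb (by rw [ec]; nlinarith) (by rw [ea]; nlinarith)
    · exact h q r p h3 h1.symm h2.symm c hc ec (by rw [ea]; nlinarith) (by rw [eb]; nlinarith)
  · rcases le_total c a with hca | hca
    · exact h p r q h2 h1 h3.symm c hc ec (by rw [eb]; nlinarith) (by rw [ea]; nlinarith)
    · exact h r q p h3.symm h2.symm h1.symm b hb eb (by rw [ea]; nlinarith) (by rw [ec]; nlinarith)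

lemma noCross_diff (X Y : Fin 3 → ℝ) (h : NoCross X Y) (p q r : Fin 3)
    (h1 : p ≠ q) (h2 : p ≠ r) (h3 : q ≠ r)
    (xp : 0 < X p) (xq : X q < 0) (xr : X r < 0) (yp : Y p < 0) (yq : 0 < Y q) (yr : Y r < 0) :
    False := by
  obtain ⟨c, hc, ec⟩ : ∃ k, 0 < k ∧ Y r = k * X r :=
    ⟨Y r / X r, div_pos_of_neg_of_neg yr xr, by field_simp [xr.ne]⟩
  exact h q r p h3 h1.symm h2.symm c hc ec (by nlinarith) (by nlinarith)

lemma noCross_out (X Y : Fin 3 → ℝ) (h : NoCross X Y)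
    (hx : ∃ p q r : Fin 3, p ≠ q ∧ p ≠ r ∧ q ≠ r ∧ 0 < X p ∧ X q < 0 ∧ X r < 0)
    (hy : ∃ p q r : Fin 3, p ≠ q ∧ p ≠ r ∧ q ≠ r ∧ 0 < Y p ∧ Y q < 0 ∧ Y r < 0) : False := by
  obtain ⟨p, q, r, h1, h2, h3, xp, xq, xr⟩ := hx
  obtain ⟨p', q', r', h1', h2', h3', yp, yq, yr⟩ := hy
  have hneg : ∀ i, i ≠ p' → Y i < 0 := by
    intro i hi
    have : i = q' ∨ i = r' := by omega
    rcases this with rfl | rfl <;> assumption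
  have hc : p' = p ∨ p' = q ∨ p' = r := by omega
  rcases hc with rfl | rfl | rfl
  · exact noCross_same X Y h _ q r h1 h2 h3 xp xq xr yp (hneg _ h1.symm) (hneg _ h2.symm)
  · exact noCross_diff X Y h p _ r h1 h2 h3 xp xq xr (hneg _ h1) yp (hneg _ h3.symm)
  · exact noCross_diff X Y h p _ q h2 h1 h3.symm xp xr xq (hneg _ h2) yp (hneg _ h3)

/-- Barycentric coordinates with respect to a non-collinear triple. -/
lemma exists_bary (e : Fin 3 → ℝ × ℝ) (hd : ¬ Collinear ℝ {e 0, e 1, e 2}) (x : ℝ × ℝ) :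
    ∃ X : Fin 3 → ℝ, X 0 + X 1 + X 2 = 1 ∧ x = X 0 • e 0 + X 1 • e 1 + X 2 • e 2 := by
  obtain ⟨D, hD⟩ : ∃ D, D = ((e 1).1 - (e 0).1) * ((e 2).2 - (e 0).2) -
    ((e 1).2 - (e 0).2) * ((e 2).1 - (e 0).1) := ⟨_, rfl⟩
  have hD0 : D ≠ 0 := by
    intro h0
    apply hd
    rw [h0] at hD
    by_cases h1 : (e 1).1 - (e 0).1 = 0
    · by_cases h2 : (e 1).2 - (e 0).2 = 0
      · have : e 1 = e 0 := Prod.ext (by linarith) (by linarith)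
        rw [this]; simpa using collinear_pair ℝ (e 0) (e 2)
      · rw [collinear_iff_of_mem (p₀ := e 0) (by simp)]
        refine ⟨e 1 - e 0, ?_⟩
        intro p hp
        simp only [Set.mem_insert_iff, Set.mem_singleton_iff] at hp
        rcases hp with rfl | rfl | rfl
        · exact ⟨0, by simp⟩
        · exact ⟨1, by simp⟩
        · refine ⟨((e 2).2 - (e 0).2) / ((e 1).2 - (e 0).2), ?_⟩
          apply Prod.ext <;> simp <;> field_simp <;> linarith
    · rw [collinear_iff_of_mem (p₀ := e 0) (by simp)]
      refine ⟨e 1 - e 0, ?_⟩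
      intro p hp
      simp only [Set.mem_insert_iff, Set.mem_singleton_iff] at hp
      rcases hp with rfl | rfl | rfl
      · exact ⟨0, by simp⟩
      · exact ⟨1, by simp⟩
      · refine ⟨((e 2).1 - (e 0).1) / ((e 1).1 - (e 0).1), ?_⟩
        apply Prod.ext <;> simp <;> field_simp <;> linarith
  obtain ⟨s, hs⟩ : ∃ s, s * D = (x.1 - (e 0).1) * ((e 2).2 - (e 0).2) -
    (x.2 - (e 0).2) * ((e 2).1 - (e 0).1) := ⟨_ / D, div_mul_cancel₀ _ hD0⟩
  obtain ⟨t, ht⟩ : ∃ t, t * D = ((e 1).1 - (e 0).1) * (x.2 - (e 0).2) -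
    ((e 1).2 - (e 0).2) * (x.1 - (e 0).1) := ⟨_ / D, div_mul_cancel₀ _ hD0⟩
  have e1 : x.1 = (1 - s - t) * (e 0).1 + s * (e 1).1 + t * (e 2).1 := by
    apply mul_left_cancel₀ hD0
    linear_combination ((e 0).1 - (e 1).1) * hs + ((e 0).1 - (e 2).1) * ht + (x.1 - (e 0).1) * hD
  have e2 : x.2 = (1 - s - t) * (e 0).2 + s * (e 1).2 + t * (e 2).2 := by
    apply mul_left_cancel₀ hD0
    linear_combination ((e 0).2 - (e 1).2) * hs + ((e 0).2 - (e 2).2) * ht + (x.2 - (e 0).2) * hD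
  refine ⟨![1 - s - t, s, t], by simp; ring, ?_⟩
  apply Prod.ext
  · simpa using e1
  · simpa using e2

lemma mem_seg_of (P u v : ℝ × ℝ) (s a b : ℝ) (hs : 0 < s) (ha : 0 ≤ a) (hb : 0 ≤ b)
    (hab : a + b = s) (hP : s • P = a • u + b • v) : P ∈ segment ℝ u v := by
  refine ⟨a / s, b / s, by positivity, by positivity, by rw [← add_div, hab, div_self hs.ne'], ?_⟩
  have : P = s⁻¹ • (s • P) := by rw [smul_smul, inv_mul_cancel₀ hs.ne', one_smul]
  rw [this, hP, smul_add, smul_smul, smul_smul]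
  congr 2 <;> ring

lemma sum_perm {M : Type} [AddCommMonoid M] (f : Fin 3 → M) (p q r : Fin 3) (h1 : p ≠ q)
    (h2 : p ≠ r) (h3 : q ≠ r) : f 0 + f 1 + f 2 = f p + f q + f r := by
  fin_cases p <;> fin_cases q <;> fin_cases r <;> simp at h1 h2 h3 ⊢ <;> abel

/-- In a planar drawing a triangle has at most two common neighbours. -/
lemma planar_no_three {V : Type} (G : SimpleGraph V) (hp : IsPlanar G) (e : Fin 3 → V)
    (he : ∀ i j, i ≠ j → G.Adj (e i) (e j)) (z : Fin 3 → V) (hz : Function.Injective z)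
    (hez : ∀ i j, G.Adj (z i) (e j)) : False := by
  obtain ⟨pos, hinj, hpl⟩ := hp
  have hcr : ∀ u v x y : V, G.Adj u v → G.Adj x y → u ≠ x → u ≠ y → v ≠ x → v ≠ y → ∀ P,
      P ∈ segment ℝ (pos u) (pos v) → P ∈ segment ℝ (pos x) (pos y) → False := by
    intro u v x y huv hxy h1 h2 h3 h4 P hP hP'
    have := hpl u v x y huv hxy (by
      intro h
      rw [Sym2.eq_iff] at h
      tauto) ⟨hP, hP'⟩
    simp only [Set.mem_inter_iff, Set.mem_insert_iff, Set.mem_singleton_iff] at this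
    obtain ⟨h5 | h5, h6 | h6⟩ := this <;> rw [h5] at h6 <;> have := hinj h6 <;> tauto
  have hcol : ¬ Collinear ℝ {pos (e 0), pos (e 1), pos (e 2)} := by
    intro h
    have key : ∀ p q r : Fin 3, p ≠ q → p ≠ r → q ≠ r →
        Wbtw ℝ (pos (e p)) (pos (e q)) (pos (e r)) → False := by
      intro p q r h1 h2 h3 hw
      exact hcr (e p) (e r) (z 0) (e q) (he _ _ h2) (hez _ _) (hez _ _).ne.symm (he _ _ h1).ne
        (hez _ _).ne.symm (he _ _ h3.symm).ne _ (mem_segment_iff_wbtw.2 hw)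
        (right_mem_segment ℝ _ _)
    rcases h.wbtw_or_wbtw_or_wbtw with h | h | h
    · exact key _ _ _ (by decide) (by decide) (by decide) h
    · exact key _ _ _ (by decide) (by decide) (by decide) h
    · exact key _ _ _ (by decide) (by decide) (by decide) h
  choose X hX1 hX2 using fun i => exists_bary (fun j => pos (e j)) hcol (pos (z i))
  have hX1' : ∀ i, ∀ p q r : Fin 3, p ≠ q → p ≠ r → q ≠ r → X i p + X i q + X i r = 1 := by
    intro i p q r h1 h2 h3
    rw [← hX1 i]; exact (sum_perm (X i) p q r h1 h2 h3).symm
  have hX2' : ∀ i, ∀ p q r : Fin 3, p ≠ q → p ≠ r → q ≠ r →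
      pos (z i) = X i p • pos (e p) + X i q • pos (e q) + X i r • pos (e r) := by
    intro i p q r h1 h2 h3
    rw [hX2 i]; exact (sum_perm (fun j => X i j • pos (e j)) p q r h1 h2 h3)
  have hcls := fun i => sign_class (X i) (hX1 i) (by
    intro p q r h1 h2 h3 hp hq hr
    have hs := hX1' i p q r h1 h2 h3
    have hv := hX2' i p q r h1 h2 h3
    have hpos : 0 < X i q + X i r := by linarith
    refine hcr (e q) (e r) (z i) (e p) (he _ _ h3) (hez _ _) (hez _ _).ne.symm (he _ _ h1.symm).ne
        (hez _ _).ne.symm (he _ _ h2.symm).ne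
        ((X i q + X i r)⁻¹ • (X i q • pos (e q) + X i r • pos (e r))) ?_ ?_
    · refine mem_seg_of _ _ _ _ _ _ hpos hq hr rfl ?_
      rw [smul_smul, mul_inv_cancel₀ hpos.ne', one_smul]
    · refine mem_seg_of _ _ _ (X i q + X i r) 1 (- X i p) hpos zero_le_one (by linarith)
        (by linarith) ?_
      rw [smul_smul, mul_inv_cancel₀ hpos.ne', one_smul, hv]
      module)
  have hno : ∀ i j, i ≠ j → NoCross (X i) (X j) := by
    intro i j hij p q r h1 h2 h3 k hk hq hr hp
    have hsi := hX1' i p q r h1 h2 h3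
    have hvi := hX2' i p q r h1 h2 h3
    have hsj := hX1' j p q r h1 h2 h3
    have hvj := hX2' j p q r h1 h2 h3
    have hpos : 0 < k + (X j p - k * X i p) := by linarith
    refine hcr (z i) (e p) (z j) (e r) (hez _ _) (hez _ _) (fun h => hij (hz h)) (hez _ _).ne
        (hez _ _).ne.symm (he _ _ h2).ne
        ((k + (X j p - k * X i p))⁻¹ • (k • pos (z i) + (X j p - k * X i p) • pos (e p))) ?_ ?_
    · refine mem_seg_of _ _ _ _ _ _ hpos hk.le (by linarith) rfl ?_
      rw [smul_smul, mul_inv_cancel₀ hpos.ne', one_smul]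
    · refine mem_seg_of _ _ _ (k + (X j p - k * X i p)) 1 (k * X i r - X j r) hpos zero_le_one
        (by linarith) (by linear_combination k * hsi - hsj + hq) ?_
      rw [smul_smul, mul_inv_cancel₀ hpos.ne', one_smul, hvi, hvj, hq]
      module
  have hpp : ∀ i j, i ≠ j → (∀ l, 0 < X i l) → (∀ l, 0 < X j l) → False :=
    fun i j hij h h' => noCross_pos _ _ (hno i j hij) h h'
  have hoo := fun i j (hij : i ≠ j) => noCross_out _ _ (hno i j hij)
  rcases hcls 0 with h0 | h0 <;> rcases hcls 1 with h1 | h1 <;> rcases hcls 2 with h2 | h2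
  · exact hpp 0 1 (by decide) h0 h1
  · exact hpp 0 1 (by decide) h0 h1
  · exact hpp 0 2 (by decide) h0 h2
  · exact hoo 1 2 (by decide) h1 h2
  · exact hpp 1 2 (by decide) h1 h2
  · exact hoo 0 2 (by decide) h0 h2
  · exact hoo 0 1 (by decide) h0 h1
  · exact hoo 0 1 (by decide) h0 h1

/-! ### Separation of boxes -/

/-- Strict separation along axis `i`. -/
def Box.SS (B C : Box) (i : Fin 3) : Prop := B.hi i < C.lo i ∨ C.hi i < B.lo i

/-- Weak separation along axis `i`. -/
def Box.WS (B C : Box) (i : Fin 3) : Prop := B.hi i ≤ C.lo i ∨ C.hi i ≤ B.lo i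

/-- The boxes are separated and do not share boundary of positive area. -/
def Box.Sep (B C : Box) : Prop := (∃ i, B.SS C i) ∨ ∃ i j, i ≠ j ∧ B.WS C i ∧ B.WS C j

/-- Containment of boxes. -/
def Box.Sub (B C : Box) : Prop := ∀ i, C.lo i ≤ B.lo i ∧ B.hi i ≤ C.hi i

/-- `B` covers a face of `R` orthogonal to axis `k`. -/
def Box.Wall (k : Fin 3) (B R : Box) : Prop :=
  (B.hi k = R.lo k ∨ R.hi k = B.lo k) ∧ ∀ j, j ≠ k → B.lo j ≤ R.lo j ∧ R.hi j ≤ B.hi j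

lemma Box.SS.symm {B C : Box} {i : Fin 3} (h : B.SS C i) : C.SS B i := Or.symm h

lemma Box.WS.symm {B C : Box} {i : Fin 3} (h : B.WS C i) : C.WS B i := Or.symm h

lemma Box.Sep.symm {B C : Box} (h : B.Sep C) : C.Sep B := by
  rcases h with ⟨i, h⟩ | ⟨i, j, hij, h, h'⟩
  · exact Or.inl ⟨i, h.symm⟩
  · exact Or.inr ⟨i, j, hij, h.symm, h'.symm⟩

lemma Box.SS.mono {B C C' : Box} {i : Fin 3} (h : B.SS C i) (hs : C'.Sub C) : B.SS C' i := by
  have := hs i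
  rcases h with h | h
  · left; linarith
  · right; linarith

lemma Box.WS.mono {B C C' : Box} {i : Fin 3} (h : B.WS C i) (hs : C'.Sub C) : B.WS C' i := by
  have := hs i
  rcases h with h | h
  · left; linarith
  · right; linarith

lemma Box.Sep.mono {B C C' : Box} (h : B.Sep C) (hs : C'.Sub C) : B.Sep C' := by
  rcases h with ⟨i, h⟩ | ⟨i, j, hij, h, h'⟩
  · exact Or.inl ⟨i, h.mono hs⟩
  · exact Or.inr ⟨i, j, hij, h.mono hs, h'.mono hs⟩

lemma Box.Contact.symm {B C : Box} (h : B.Contact C) : C.Contact B := by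
  obtain ⟨i, h, h'⟩ := h
  refine ⟨i, Or.symm h, fun j hj => ?_⟩
  rw [max_comm, min_comm]
  exact h' j hj

lemma Box.Wall.contact {k : Fin 3} {B R : Box} (h : Box.Wall k B R) : B.Contact R := by
  refine ⟨k, h.1, fun j hj => ?_⟩
  have := h.2 j hj
  rw [max_eq_right this.1, min_eq_right this.2]
  exact R.lo_lt_hi j

lemma Box.Sep.not_contact {B C : Box} (h : B.Sep C) : ¬ B.Contact C := by
  rintro ⟨i, hi, hj⟩
  have key : ∀ j, B.WS C j → j = i := by
    intro j hw
    by_contra hne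
    have := hj j hne
    simp only [lt_min_iff, max_lt_iff] at this
    rcases hw with hw | hw <;> linarith [this.1.1, this.1.2, this.2.1, this.2.2]
  rcases h with ⟨j, h⟩ | ⟨j, l, hjl, h, h'⟩
  · have : j = i := key j (by rcases h with h | h; exacts [Or.inl h.le, Or.inr h.le])
    subst this
    have h1 := B.lo_lt_hi j
    have h2 := C.lo_lt_hi j
    rcases h with h | h <;> rcases hi with hi | hi <;> linarith
  · exact hjl ((key j h).trans (key l h').symm)

lemma Box.WS.disjoint {B C : Box} {i : Fin 3} (h : B.WS C i) :
    Disjoint B.interior C.interior := by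
  rw [Set.disjoint_left]
  intro p hp hq
  have h1 := hp i
  have h2 := hq i
  rcases h with h | h <;> linarith [h1.1, h1.2, h2.1, h2.2]

lemma Box.Sep.disjoint {B C : Box} (h : B.Sep C) : Disjoint B.interior C.interior := by
  rcases h with ⟨i, h⟩ | ⟨i, j, hij, h, h'⟩
  · exact Box.WS.disjoint (i := i) (by rcases h with h | h; exacts [Or.inl h.le, Or.inr h.le])
  · exact h.disjoint

lemma Box.Contact.disjoint {B C : Box} (h : B.Contact C) : Disjoint B.interior C.interior := by
  obtain ⟨i, h, -⟩ := h
  exact Box.WS.disjoint (i := i) (by rcases h with h | h; exacts [Or.inl h.le, Or.inr h.le])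

/-- Splitting an interval into a near and a far part. -/
lemma split_axis (lo hi wl wh c : ℝ) (hlt : lo < hi) (hc : 0 < c) (hw : wh = lo ∨ hi = wl) :
    ∃ nl nh fl fh : ℝ, lo ≤ nl ∧ nh ≤ hi ∧ lo ≤ fl ∧ fh ≤ hi ∧ nl < nh ∧ fl < fh ∧
      (1 + c) * (nh - nl) = hi - lo ∧ fh - fl = c * (nh - nl) ∧ (nh = fl ∨ fh = nl) ∧
      (wh = nl ∨ nh = wl) ∧ (wh < fl ∨ fh < wl) := by
  obtain ⟨l, hl⟩ : ∃ l, (1 + c) * l = hi - lo :=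
    ⟨(hi - lo) / (1 + c), mul_div_cancel₀ _ (by positivity)⟩
  have hl0 : 0 < l := by
    by_contra h
    nlinarith
  have hcl : 0 < c * l := mul_pos hc hl0
  rcases hw with h | h
  · exact ⟨lo, lo + l, lo + l, hi, by linarith, by linarith, by linarith, by linarith, by linarith,
      by linarith, by linarith, by linarith, Or.inl rfl, Or.inl h, Or.inl (by linarith)⟩
  · exact ⟨hi - l, hi, lo, hi - l, by linarith, by linarith, by linarith, by linarith, by linarith,
      by linarith, by linarith, by linarith, Or.inr rfl, Or.inr h, Or.inr (by linarith)⟩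

/-- Subdividing a corner region: a new box in the corner and three new corner regions. -/
lemma subdivide (R : Box) (W : Fin 3 → Box) (hW : ∀ k, Box.Wall k (W k) R) (w : ℝ) (hw : 0 < w)
    (m : Fin 3 → ℝ) (hm : ∀ k, 0 < m k) (hvol : R.volume = w * ∏ k, (1 + m k / w)) :
    ∃ (B : Box) (Q : Fin 3 → Box), B.volume = w ∧ (∀ k, (Q k).volume = m k) ∧ B.Sub R ∧
      (∀ k, (Q k).Sub R) ∧ (∀ k, Box.Wall k (W k) B) ∧ (∀ k, Box.Wall k B (Q k)) ∧
      (∀ k j, j ≠ k → Box.Wall j (W j) (Q k)) ∧ (∀ k, (W k).SS (Q k) k) ∧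
      (∀ k l, k ≠ l → (Q k).Sep (Q l)) := by
  have hax := fun k => split_axis (R.lo k) (R.hi k) ((W k).lo k) ((W k).hi k) (m k / w)
    (R.lo_lt_hi k) (div_pos (hm k) hw) (hW k).1
  choose nl nh fl fh h1 h2 h3 h4 h5 h6 h7 h8 h9 h10 h11 using hax
  have hprod : ∏ k, (nh k - nl k) = w := by
    have hp : 0 < ∏ k, (1 + m k / w) :=
      Finset.prod_pos fun k _ => by have := div_pos (hm k) hw; linarith
    have : (∏ k, (1 + m k / w)) * ∏ k, (nh k - nl k) = (∏ k, (1 + m k / w)) * w := by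
      rw [← Finset.prod_mul_distrib, mul_comm _ w, ← hvol]
      exact Finset.prod_congr rfl fun k _ => h7 k
    exact mul_left_cancel₀ hp.ne' this
  let B : Box := ⟨nl, nh, h5⟩
  let Q : Fin 3 → Box := fun k => ⟨Function.update nl k (fl k), Function.update nh k (fh k), by
    intro i
    by_cases h : i = k
    · subst h; simpa using h6 i
    · simpa [h] using h5 i⟩
  have Qlo : ∀ k, (Q k).lo k = fl k := fun k => by simp [Q]
  have Qhi : ∀ k, (Q k).hi k = fh k := fun k => by simp [Q]
  have Qlo' : ∀ k j, j ≠ k → (Q k).lo j = nl j := fun k j h => by simp [Q, h]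
  have Qhi' : ∀ k j, j ≠ k → (Q k).hi j = nh j := fun k j h => by simp [Q, h]
  have hB : B.Sub R := fun i => ⟨h1 i, h2 i⟩
  have hQ : ∀ k, (Q k).Sub R := by
    intro k i
    by_cases h : i = k
    · subst h; rw [Qlo, Qhi]; exact ⟨h3 i, h4 i⟩
    · rw [Qlo' k i h, Qhi' k i h]; exact ⟨h1 i, h2 i⟩
  refine ⟨B, Q, hprod, ?_, hB, hQ, ?_, ?_, ?_, ?_, ?_⟩
  · intro k
    have : (Q k).volume = (m k / w) * ∏ k, (nh k - nl k) := by
      unfold Box.volume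
      rw [← Finset.mul_prod_erase _ _ (Finset.mem_univ k),
        ← Finset.mul_prod_erase _ (fun k => nh k - nl k) (Finset.mem_univ k), Qlo, Qhi, h8,
        ← mul_assoc]
      congr 1
      apply Finset.prod_congr rfl
      intro j hj
      rw [Qlo' k j (Finset.ne_of_mem_erase hj), Qhi' k j (Finset.ne_of_mem_erase hj)]
    rw [this, hprod, div_mul_cancel₀ _ hw.ne']
  · intro k
    refine ⟨h10 k, fun j hj => ?_⟩
    have := (hW k).2 j hj
    have := hB j
    constructor <;> linarith
  · intro k
    refine ⟨?_, fun j hj => ?_⟩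
    · rw [Qlo, Qhi]; exact h9 k
    · rw [Qlo' k j hj, Qhi' k j hj]; exact ⟨le_rfl, le_rfl⟩
  · intro k j hj
    refine ⟨?_, fun i hi => ?_⟩
    · rw [Qlo' k j hj, Qhi' k j hj]; exact h10 j
    · have := (hW j).2 i hi
      have := hQ k i
      constructor <;> linarith
  · intro k
    unfold Box.SS
    rw [Qlo, Qhi]; exact h11 k
  · intro k l hkl
    refine Or.inr ⟨k, l, hkl, ?_, ?_⟩
    · unfold Box.WS
      rw [Qlo, Qhi, Qlo' l k hkl, Qhi' l k hkl]
      rcases h9 k with h | h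
      · right; exact h.le
      · left; exact h.le
    · unfold Box.WS
      rw [Qlo, Qhi, Qlo' k l hkl.symm, Qhi' k l hkl.symm]
      rcases h9 l with h | h
      · left; exact h.le
      · right; exact h.le

/-- Boxes for the root triangle with its two corner regions. -/
lemma base_boxes (wa wb wc n0 n1 : ℝ) (ha : 0 < wa) (hb : 0 < wb) (hc : 0 < wc) (h0 : 0 < n0)
    (h1 : 0 < n1) : ∃ A B C R0 R1 : Box, A.volume = wa ∧ B.volume = wb ∧ C.volume = wc ∧
      R0.volume = n0 ∧ R1.volume = n1 ∧ A.Contact B ∧ A.Contact C ∧ B.Contact C ∧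
      Box.Wall 0 A R0 ∧ Box.Wall 1 B R0 ∧ Box.Wall 2 C R0 ∧
      Box.Wall 0 A R1 ∧ Box.Wall 1 B R1 ∧ Box.Wall 2 C R1 ∧ R0.Sep R1 := by
  obtain ⟨H, hH⟩ : ∃ H, H = wc + n0 + n1 := ⟨_, rfl⟩
  have hH0 : 0 < H := by linarith
  obtain ⟨q, hq, hq0⟩ : ∃ q, q * H = wb ∧ 0 < q :=
    ⟨wb / H, div_mul_cancel₀ _ hH0.ne', by positivity⟩
  obtain ⟨p, hp, hp0⟩ : ∃ p, p * ((1 + q) * H) = wa ∧ 0 < p :=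
    ⟨wa / ((1 + q) * H), div_mul_cancel₀ _ (by positivity), by positivity⟩
  let A : Box := ⟨![-p, -q, -n1], ![0, 1, wc + n0], by
    intro i; fin_cases i <;> simp <;> linarith⟩
  let B : Box := ⟨![0, -q, -n1], ![1, 0, wc + n0], by
    intro i; fin_cases i <;> simp <;> linarith⟩
  let C : Box := ⟨![0, 0, 0], ![1, 1, wc], by
    intro i; fin_cases i <;> simp <;> linarith⟩
  let R0 : Box := ⟨![0, 0, wc], ![1, 1, wc + n0], by
    intro i; fin_cases i <;> simp <;> linarith⟩
  let R1 : Box := ⟨![0, 0, -n1], ![1, 1, 0], by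
    intro i; fin_cases i <;> simp <;> linarith⟩
  have hAC : Box.Wall 0 A C := by
    refine ⟨by simp [A, C], fun j hj => ?_⟩
    fin_cases j <;> simp [A, C] at hj ⊢ <;> first | linarith | (constructor <;> linarith)
  have hBC : Box.Wall 1 B C := by
    refine ⟨by simp [B, C], fun j hj => ?_⟩
    fin_cases j <;> simp [B, C] at hj ⊢ <;> first | linarith | (constructor <;> linarith)
  have hAB : Box.Wall 0 A B := by
    refine ⟨by simp [A, B], fun j hj => ?_⟩
    fin_cases j <;> simp [A, B] at hj ⊢
  refine ⟨A, B, C, R0, R1, ?_, ?_, ?_, ?_, ?_, hAB.contact, hAC.contact, hBC.contact, ?_, ?_, ?_,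
    ?_, ?_, ?_, ?_⟩
  · simp [Box.volume, Fin.prod_univ_three, A]
    rw [← hp, hH]; ring
  · simp [Box.volume, Fin.prod_univ_three, B]
    rw [← hq, hH]
  · simp [Box.volume, Fin.prod_univ_three, C]
  · simp [Box.volume, Fin.prod_univ_three, R0]
  · simp [Box.volume, Fin.prod_univ_three, R1]
  · refine ⟨by simp [A, R0], fun j hj => ?_⟩
    fin_cases j <;> simp [A, R0] at hj ⊢ <;> linarith
  · refine ⟨by simp [B, R0], fun j hj => ?_⟩
    fin_cases j <;> simp [B, R0] at hj ⊢ <;> linarith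
  · refine ⟨by simp [C, R0], fun j hj => ?_⟩
    fin_cases j <;> simp [C, R0] at hj ⊢
  · refine ⟨by simp [A, R1], fun j hj => ?_⟩
    fin_cases j <;> simp [A, R1] at hj ⊢ <;> linarith
  · refine ⟨by simp [B, R1], fun j hj => ?_⟩
    fin_cases j <;> simp [B, R1] at hj ⊢ <;> linarith
  · refine ⟨by simp [C, R1], fun j hj => ?_⟩
    fin_cases j <;> simp [C, R1] at hj ⊢
  · exact Or.inl ⟨2, Or.inr (by simpa [R0, R1] using hc)⟩

/-! ### Combinatorial structure -/

/-- Building up a 3-tree on a subset of the ambient vertex type. -/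
inductive Build {V : Type} [DecidableEq V] (G : SimpleGraph V) : Finset V → Prop
  | base (a b c : V) : G.Adj a b → G.Adj a c → G.Adj b c → Build G {a, b, c}
  | step (S T : Finset V) (v : V) : Build G S → v ∉ S → T ⊆ S → T.card = 3 →
      (∀ a ∈ T, ∀ b ∈ T, a ≠ b → G.Adj a b) → (∀ u ∈ S, G.Adj v u ↔ u ∈ T) →
      Build G (insert v S)

lemma build_of_tree {V : Type} [DecidableEq V] (G : SimpleGraph V) :
    ∀ (n : ℕ) (W : Type) [Fintype W] [DecidableEq W] (H : SimpleGraph W) (f : W ↪ V),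
      Fintype.card W = n → (∀ x y, H.Adj x y ↔ G.Adj (f x) (f y)) → IsThreeTree H →
      Build G (Finset.univ.map f) := by
  intro n
  induction n using Nat.strong_induction_on with
  | _ n ih =>
  intro W _ _ H f hn hf ht
  rw [IsThreeTree] at ht
  rcases ht with ⟨h3, hadj⟩ | ⟨v, h3, hcl, ht⟩
  · rw [← Finset.card_univ, Finset.card_eq_three] at h3
    obtain ⟨a, b, c, hab, hac, hbc, hu⟩ := h3
    rw [hu]
    simp only [Finset.map_insert, Finset.map_singleton]
    exact Build.base _ _ _ ((hf _ _).1 (hadj _ _ hab)) ((hf _ _).1 (hadj _ _ hac))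
      ((hf _ _).1 (hadj _ _ hbc))
  · have hb := ih _ (by rw [← hn]; exact Fintype.card_subtype_lt (x := v) (by simp)) _ _
      ((Function.Embedding.subtype _).trans f) rfl (by
        intro x y
        simpa using hf x y) ht
    classical
    have hS : (Finset.univ : Finset W).map f = insert (f v)
        (Finset.univ.map ((Function.Embedding.subtype (fun u => u ∈ {u : W | u ≠ v})).trans f)) := by
      ext y
      simp only [Finset.mem_map, Finset.mem_univ, true_and, Finset.mem_insert]
      constructor
      · rintro ⟨x, rfl⟩
        by_cases hx : x = v
        · left; rw [hx]
        · right; exact ⟨⟨x, hx⟩, rfl⟩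
      · rintro (rfl | ⟨x, rfl⟩)
        · exact ⟨v, rfl⟩
        · exact ⟨x, rfl⟩
    rw [hS]
    refine Build.step _ ((H.neighborSet v).toFinite.toFinset.map f) (f v) hb ?_ ?_ ?_ ?_ ?_
    · simp
    · intro y hy
      simp only [Finset.mem_map, Set.Finite.mem_toFinset, SimpleGraph.mem_neighborSet] at hy
      obtain ⟨x, hx, rfl⟩ := hy
      simp only [Finset.mem_map, Finset.mem_univ, true_and]
      exact ⟨⟨x, hx.ne.symm⟩, rfl⟩
    · rw [Finset.card_map, ← h3, Set.ncard_eq_toFinset_card]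
    · intro a ha b hb hab
      simp only [Finset.mem_map, Set.Finite.mem_toFinset] at ha hb
      obtain ⟨x, hx, rfl⟩ := ha
      obtain ⟨y, hy, rfl⟩ := hb
      exact (hf _ _).1 (hcl x hx y hy (fun h => hab (by rw [h])))
    · intro u hu
      simp only [Finset.mem_map, Finset.mem_univ, true_and] at hu
      obtain ⟨⟨x, hx⟩, rfl⟩ := hu
      simp [← hf]

open Classical in
/-- Common neighbours in `S` of the set `T`. -/
noncomputable def comN {V : Type} (G : SimpleGraph V) (S T : Finset V) : Finset V :=
  S.filter (fun u => ∀ t ∈ T, G.Adj u t)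

/-- The `i`-th side of the triangle `T` is a face. -/
def Act {V : Type} (G : SimpleGraph V) (S T : Finset V) (i : ℕ) : Prop :=
  T ⊆ S ∧ T.card = 3 ∧ (∀ a ∈ T, ∀ b ∈ T, a ≠ b → G.Adj a b) ∧ (comN G S T).card + i ≤ 1

/-- A representation of `G` on `S` together with corner regions for the faces. -/
structure FaceRep {V : Type} [DecidableEq V] (G : SimpleGraph V) (S : Finset V) (w : V → ℝ)
    (n : Finset V → ℕ → ℝ) (ρ : V → Box) (R : Finset V → ℕ → Box) : Prop where
  vol : ∀ v ∈ S, (ρ v).volume = w v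
  con : ∀ u ∈ S, ∀ v ∈ S, G.Adj u v → (ρ u).Contact (ρ v)
  sep : ∀ u ∈ S, ∀ v ∈ S, u ≠ v → ¬ G.Adj u v → (ρ u).Sep (ρ v)
  rvol : ∀ T i, Act G S T i → (R T i).volume = n T i
  rsep : ∀ T i, Act G S T i → ∀ u ∈ S, u ∉ T → (ρ u).Sep (R T i)
  rrsep : ∀ T i T' i', Act G S T i → Act G S T' i' → (T, i) ≠ (T', i') → (R T i).Sep (R T' i')
  wall : ∀ T i, Act G S T i → ∃ σ : Fin 3 → V, Function.Injective σ ∧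
    Finset.univ.image σ = T ∧ ∀ k, Box.Wall k (ρ (σ k)) (R T i)

lemma rep_base {V : Type} [DecidableEq V] (G : SimpleGraph V) (a b c : V) (hab : G.Adj a b)
    (hac : G.Adj a c) (hbc : G.Adj b c) (w : V → ℝ) (hw : ∀ v, 0 < w v)
    (n : Finset V → ℕ → ℝ) (hn : ∀ T i, 0 < n T i) : ∃ ρ R, FaceRep G {a, b, c} w n ρ R := by
  obtain ⟨A, B, C, R0, R1, vA, vB, vC, v0, v1, cAB, cAC, cBC, wA0, wB0, wC0, wA1, wB1, wC1, hs⟩ :=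
    base_boxes (w a) (w b) (w c) (n {a, b, c} 0) (n {a, b, c} 1) (hw a) (hw b) (hw c) (hn _ _)
      (hn _ _)
  have ab := hab.ne
  have ac := hac.ne
  have bc := hbc.ne
  obtain ⟨ρ, ρa, ρb, ρc⟩ : ∃ ρ : V → Box, ρ a = A ∧ ρ b = B ∧ ρ c = C :=
    ⟨fun u => if u = a then A else if u = b then B else C, by simp, by simp [ab.symm],
      by simp [ac.symm, bc.symm]⟩
  have hact : ∀ T i, Act G {a, b, c} T i → T = {a, b, c} ∧ (i = 0 ∨ i = 1) := by
    rintro T i ⟨h1, h2, -, h4⟩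
    refine ⟨Finset.eq_of_subset_of_card_le h1 ?_, by omega⟩
    rw [h2]; exact Finset.card_le_three
  refine ⟨ρ, fun _ i => if i = 0 then R0 else R1, ?_, ?_, ?_, ?_, ?_, ?_, ?_⟩
  · intro v hv
    simp only [Finset.mem_insert, Finset.mem_singleton] at hv
    rcases hv with rfl | rfl | rfl <;> simp [*]
  · intro u hu v hv huv
    simp only [Finset.mem_insert, Finset.mem_singleton] at hu hv
    rcases hu with rfl | rfl | rfl <;> rcases hv with rfl | rfl | rfl <;>
      first
      | exact absurd rfl huv.ne
      | (simp only [ρa, ρb, ρc]; assumption)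
      | (simp only [ρa, ρb, ρc]; apply Box.Contact.symm; assumption)
  · intro u hu v hv huv hn
    simp only [Finset.mem_insert, Finset.mem_singleton] at hu hv
    rcases hu with rfl | rfl | rfl <;> rcases hv with rfl | rfl | rfl <;>
      first
      | exact absurd rfl huv
      | exact absurd (by assumption) hn
      | exact absurd (SimpleGraph.Adj.symm (by assumption)) hn
  · intro T i h
    obtain ⟨rfl, rfl | rfl⟩ := hact T i h
    · simpa using v0
    · simpa using v1
  · intro T i h u hu hu'
    obtain ⟨rfl, -⟩ := hact T i h
    exact absurd hu hu'
  · intro T i T' i' h h' hne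
    obtain ⟨rfl, rfl | rfl⟩ := hact T i h <;> obtain ⟨rfl, rfl | rfl⟩ := hact T' i' h'
    · exact absurd rfl hne
    · simpa using hs
    · simpa using hs.symm
    · exact absurd rfl hne
  · intro T i h
    obtain ⟨rfl, hi⟩ := hact T i h
    refine ⟨![a, b, c], ?_, ?_, ?_⟩
    · intro x y hxy
      fin_cases x <;> fin_cases y <;> simp [ab, ac, bc, ab.symm, ac.symm, bc.symm] at hxy ⊢
    · ext x
      simp [Fin.exists_fin_succ, eq_comm]
    · intro k
      rcases hi with rfl | rfl <;> fin_cases k <;> simpa [ρa, ρb, ρc]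

lemma rep_step {V : Type} [DecidableEq V] (G : SimpleGraph V) (S T : Finset V) (v : V)
    (hv : v ∉ S) (hTS : T ⊆ S) (hT3 : T.card = 3)
    (hTc : ∀ a ∈ T, ∀ b ∈ T, a ≠ b → G.Adj a b) (hvT : ∀ u ∈ S, G.Adj v u ↔ u ∈ T)
    (hcn : (comN G S T).card ≤ 1)
    (w : V → ℝ) (hw : ∀ v, 0 < w v)
    (ih : ∀ n : Finset V → ℕ → ℝ, (∀ T i, 0 < n T i) → ∃ ρ R, FaceRep G S w n ρ R)
    (n : Finset V → ℕ → ℝ) (hn : ∀ T i, 0 < n T i) :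
    ∃ ρ R, FaceRep G (insert v S) w n ρ R := by
  classical
  obtain ⟨i0, hi0⟩ : ∃ i0, (comN G S T).card + i0 = 1 := ⟨1 - (comN G S T).card, by omega⟩
  have hact0 : Act G S T i0 := ⟨hTS, hT3, hTc, hi0.le⟩
  obtain ⟨M, hM⟩ : ∃ M, M = w v * ∏ t ∈ T, (1 + n (insert v (T.erase t)) 0 / w v) := ⟨_, rfl⟩
  have hMpos : 0 < M := by
    rw [hM]
    refine mul_pos (hw v) (Finset.prod_pos fun t _ => ?_)
    have := div_pos (hn (insert v (T.erase t)) 0) (hw v)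
    linarith
  obtain ⟨ρ, R, h⟩ := ih (fun T' i => if T' = T ∧ i = i0 then M else n T' i) (by
    intro T' i
    split_ifs
    · exact hMpos
    · exact hn _ _)
  obtain ⟨σ, hσ, hσT, hσW⟩ := h.wall T i0 hact0
  have hσmem : ∀ k, σ k ∈ T := fun k => by rw [← hσT]; simp
  have hσsurj : ∀ t ∈ T, ∃ k, σ k = t := fun t ht => by
    rw [← hσT] at ht; simpa using ht
  have hvT' : v ∉ T := fun h => hv (hTS h)
  -- the new triangles
  obtain ⟨F, hF⟩ : ∃ F : Fin 3 → Finset V, ∀ k, F k = insert v (T.erase (σ k)) :=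
    ⟨_, fun _ => rfl⟩
  have hFinj : Function.Injective F := by
    intro k l hkl
    by_contra hne
    have h1 : σ k ∈ F l := by
      rw [hF]
      exact Finset.mem_insert_of_mem (Finset.mem_erase.2 ⟨fun h => hne (hσ h), hσmem k⟩)
    rw [← hkl, hF, Finset.mem_insert] at h1
    rcases h1 with h1 | h1
    · exact hvT' (h1 ▸ hσmem k)
    · exact absurd rfl (Finset.ne_of_mem_erase h1)
  have hvF : ∀ k, v ∈ F k := fun k => by rw [hF]; exact Finset.mem_insert_self _ _
  obtain ⟨B, Q, vB, vQ, sB, sQ, wB, wBQ, wWQ, ssQ, sepQ⟩ := subdivide (R T i0) (fun k => ρ (σ k))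
    hσW (w v) (hw v) (fun k => n (F k) 0) (fun k => hn _ _) (by
      rw [h.rvol T i0 hact0]
      simp only [and_self, if_true]
      rw [hM, ← hσT, Finset.prod_image (fun a _ b _ hab => hσ hab)]
      simp only [hF, hσT])
  obtain ⟨g, hg⟩ : ∃ g : Finset V → Fin 3, ∀ k, g (F k) = k :=
    ⟨Function.invFun F, Function.leftInverse_invFun hFinj⟩
  -- classification of the active sides
  have hcls : ∀ T' i, Act G (insert v S) T' i →
      (v ∉ T' ∧ Act G S T' i ∧ (T', i) ≠ (T, i0)) ∨ (∃ k, T' = F k ∧ i = 0) := by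
    rintro T' i ⟨g1, g2, g3, g4⟩
    by_cases hvT'' : v ∈ T'
    · right
      have hsub : T'.erase v ⊆ T := by
        intro u hu
        have hu1 := Finset.ne_of_mem_erase hu
        have hu2 := Finset.mem_of_mem_erase hu
        have hu3 : u ∈ S := by
          have := g1 hu2
          rw [Finset.mem_insert] at this
          exact this.resolve_left hu1
        exact (hvT u hu3).1 (g3 v hvT'' u hu2 hu1.symm)
      have hcard : (T'.erase v).card = 2 := by rw [Finset.card_erase_of_mem hvT'', g2]
      obtain ⟨t, ht, ht'⟩ : ∃ t ∈ T, t ∉ T'.erase v := by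
        by_contra hcon
        push Not at hcon
        have := Finset.card_le_card (show T ⊆ T'.erase v from hcon)
        omega
      obtain ⟨k, rfl⟩ := hσsurj t ht
      have heq : T'.erase v = T.erase (σ k) := by
        apply Finset.eq_of_subset_of_card_le
        · intro u hu
          exact Finset.mem_erase.2 ⟨fun h => ht' (h ▸ hu), hsub hu⟩
        · rw [Finset.card_erase_of_mem ht, hT3, hcard]
      refine ⟨k, ?_, ?_⟩
      · rw [hF, ← heq, Finset.insert_erase hvT'']
      · have : σ k ∈ comN G (insert v S) T' := by
          unfold comN
          rw [Finset.mem_filter]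
          refine ⟨Finset.mem_insert_of_mem (hTS ht), fun u hu => ?_⟩
          by_cases huv : u = v
          · rw [huv]; exact ((hvT _ (hTS ht)).2 ht).symm
          · have hu' : u ∈ T'.erase v := Finset.mem_erase.2 ⟨huv, hu⟩
            exact hTc _ ht _ (hsub hu') (fun h => ht' (h ▸ hu'))
        have := Finset.card_pos.2 ⟨_, this⟩
        omega
    · left
      have hsub : T' ⊆ S := fun u hu => by
        have := g1 hu
        rw [Finset.mem_insert] at this
        exact this.resolve_left (fun h => hvT'' (h ▸ hu))
      have hcs : comN G S T' ⊆ comN G (insert v S) T' :=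
        Finset.filter_subset_filter _ (Finset.subset_insert _ _)
      have hcc := Finset.card_le_card hcs
      refine ⟨hvT'', ⟨hsub, g2, g3, by omega⟩, ?_⟩
      intro heq
      rw [Prod.mk.injEq] at heq
      obtain ⟨rfl, rfl⟩ := heq
      have hlt : (comN G S T').card < (comN G (insert v S) T').card := by
        apply Finset.card_lt_card
        refine Finset.ssubset_iff_subset_ne.2 ⟨hcs, fun heq => ?_⟩
        have h1 : v ∈ comN G (insert v S) T' := by
          unfold comN
          rw [Finset.mem_filter]
          exact ⟨Finset.mem_insert_self _ _, fun u hu => (hvT u (hsub hu)).2 hu⟩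
        rw [← heq] at h1
        exact hv (Finset.mem_of_mem_filter _ h1)
      omega
  obtain ⟨ρ', ρv, ρS⟩ : ∃ ρ' : V → Box, ρ' v = B ∧ ∀ u ∈ S, ρ' u = ρ u :=
    ⟨Function.update ρ v B, by simp, fun u hu => by
      have hne : u ≠ v := fun h => hv (h ▸ hu)
      simp [hne]⟩
  obtain ⟨R', RF, RS⟩ : ∃ R' : Finset V → ℕ → Box, (∀ k, R' (F k) 0 = Q k) ∧
      ∀ T' i, v ∉ T' → R' T' i = R T' i :=
    ⟨fun T' i => if v ∈ T' then Q (g T') else R T' i, fun k => by simp [hvF, hg],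
      fun T' i h => by simp [h]⟩
  refine ⟨ρ', R', ?_, ?_, ?_, ?_, ?_, ?_, ?_⟩
  · intro u hu
    rw [Finset.mem_insert] at hu
    rcases hu with rfl | hu
    · rw [ρv, vB]
    · rw [ρS u hu, h.vol u hu]
  · have key : ∀ u ∈ S, G.Adj v u → (ρ u).Contact B := by
      intro u hu hadj
      obtain ⟨k, rfl⟩ := hσsurj u ((hvT u hu).1 hadj)
      exact (wB k).contact
    intro x hx y hy hxy
    rw [Finset.mem_insert] at hx hy
    rcases hx with rfl | hx <;> rcases hy with rfl | hy
    · exact absurd rfl hxy.ne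
    · rw [ρv, ρS y hy]; exact (key y hy hxy).symm
    · rw [ρv, ρS x hx]; exact key x hx hxy.symm
    · rw [ρS x hx, ρS y hy]; exact h.con x hx y hy hxy
  · have key : ∀ u ∈ S, ¬ G.Adj v u → (ρ u).Sep B := by
      intro u hu hadj
      exact (h.rsep T i0 hact0 u hu (fun h => hadj ((hvT u hu).2 h))).mono sB
    intro x hx y hy hne hxy
    rw [Finset.mem_insert] at hx hy
    rcases hx with rfl | hx <;> rcases hy with rfl | hy
    · exact absurd rfl hne
    · rw [ρv, ρS y hy]; exact (key y hy hxy).symm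
    · rw [ρv, ρS x hx]; exact key x hx (fun h => hxy h.symm)
    · rw [ρS x hx, ρS y hy]; exact h.sep x hx y hy hne hxy
  · intro T' i hact
    rcases hcls T' i hact with ⟨h1, h2, h3⟩ | ⟨k, rfl, rfl⟩
    · rw [RS T' i h1, h.rvol T' i h2, if_neg]
      rintro ⟨rfl, rfl⟩
      exact h3 rfl
    · rw [RF, vQ]
  · intro T' i hact u hu hu'
    rw [Finset.mem_insert] at hu
    rcases hcls T' i hact with ⟨h1, h2, h3⟩ | ⟨k, rfl, rfl⟩
    · rw [RS T' i h1]
      rcases hu with rfl | hu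
      · rw [ρv]
        exact ((h.rrsep T' i T i0 h2 hact0 h3).mono sB).symm
      · rw [ρS u hu]
        exact h.rsep T' i h2 u hu hu'
    · rw [RF]
      rcases hu with rfl | hu
      · exact absurd (hvF k) hu'
      · rw [ρS u hu]
        by_cases huT : u ∈ T
        · have : u = σ k := by
            by_contra hne
            apply hu'
            rw [hF]
            exact Finset.mem_insert_of_mem (Finset.mem_erase.2 ⟨hne, huT⟩)
          subst this
          exact Or.inl ⟨k, ssQ k⟩
        · exact (h.rsep T i0 hact0 u hu huT).mono (sQ k)
  · intro T' i T'' j hact hact' hne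
    rcases hcls T' i hact with ⟨h1, h2, h3⟩ | ⟨k, rfl, rfl⟩ <;>
      rcases hcls T'' j hact' with ⟨g1, g2, g3⟩ | ⟨l, rfl, rfl⟩
    · rw [RS T' i h1, RS T'' j g1]
      exact h.rrsep _ _ _ _ h2 g2 hne
    · rw [RS T' i h1, RF]
      exact (h.rrsep _ _ _ _ h2 hact0 h3).mono (sQ l)
    · rw [RS T'' j g1, RF]
      exact ((h.rrsep _ _ _ _ g2 hact0 g3).mono (sQ k)).symm
    · rw [RF, RF]
      exact sepQ k l (fun h => hne (by rw [h]))
  · intro T' i hact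
    rcases hcls T' i hact with ⟨h1, h2, h3⟩ | ⟨k, rfl, rfl⟩
    · obtain ⟨τ, h4, h5, h6⟩ := h.wall T' i h2
      refine ⟨τ, h4, h5, fun l => ?_⟩
      have : τ l ∈ T' := by rw [← h5]; simp
      rw [RS T' i h1, ρS _ (h2.1 this)]
      exact h6 l
    · have hne : ∀ l, σ l ≠ v := fun l h => hvT' (h ▸ hσmem l)
      refine ⟨Function.update σ k v, ?_, ?_, ?_⟩
      · intro a b hab
        by_cases ha : a = k <;> by_cases hb : b = k
        · rw [ha, hb]
        · rw [ha, Function.update_self, Function.update_of_ne hb] at hab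
          exact absurd hab.symm (hne b)
        · rw [hb, Function.update_self, Function.update_of_ne ha] at hab
          exact absurd hab (hne a)
        · rw [Function.update_of_ne ha, Function.update_of_ne hb] at hab
          exact hσ hab
      · rw [hF]
        ext x
        simp only [Finset.mem_image, Finset.mem_univ, true_and, Finset.mem_insert,
          Finset.mem_erase]
        constructor
        · rintro ⟨l, rfl⟩
          by_cases hl : l = k
          · left; rw [hl, Function.update_self]
          · right
            rw [Function.update_of_ne hl]
            exact ⟨fun h => hl (hσ h), hσmem l⟩
        · rintro (rfl | ⟨hx1, hx2⟩)
          · exact ⟨k, Function.update_self _ _ _⟩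
          · obtain ⟨l, rfl⟩ := hσsurj x hx2
            exact ⟨l, Function.update_of_ne (fun h => hx1 (by rw [h])) _ _⟩
      · intro l
        rw [RF]
        by_cases hl : l = k
        · subst hl
          rw [Function.update_self, ρv]
          exact wBQ l
        · rw [Function.update_of_ne hl, ρS _ (hTS (hσmem l))]
          exact wWQ k l hl

lemma rep_of_build {V : Type} [DecidableEq V] (G : SimpleGraph V)
    (hK : ∀ S T : Finset V, T.card = 3 → (∀ a ∈ T, ∀ b ∈ T, a ≠ b → G.Adj a b) →
      (comN G S T).card ≤ 2)
    (w : V → ℝ) (hw : ∀ v, 0 < w v) (S : Finset V) (hS : Build G S) :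
    ∀ n : Finset V → ℕ → ℝ, (∀ T i, 0 < n T i) → ∃ ρ R, FaceRep G S w n ρ R := by
  induction hS with
  | base a b c hab hac hbc => exact fun n hn => rep_base G a b c hab hac hbc w hw n hn
  | step S T v _ hv hTS hT3 hTc hvT ih =>
    refine rep_step G S T v hv hTS hT3 hTc hvT ?_ w hw ih
    classical
    have hlt : (comN G S T).card < (comN G (insert v S) T).card := by
      apply Finset.card_lt_card
      refine Finset.ssubset_iff_subset_ne.2
        ⟨Finset.filter_subset_filter _ (Finset.subset_insert _ _), fun heq => ?_⟩
      have h1 : v ∈ comN G (insert v S) T := by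
        unfold comN
        rw [Finset.mem_filter]
        exact ⟨Finset.mem_insert_self _ _, fun u hu => (hvT u (hTS hu)).2 hu⟩
      rw [← heq] at h1
      exact hv (Finset.mem_of_mem_filter _ h1)
    have := hK (insert v S) T hT3 hTc
    omega

lemma comN_le_two {V : Type} (G : SimpleGraph V) (hp : IsPlanar G)
    (S T : Finset V) (hT : T.card = 3) (hc : ∀ a ∈ T, ∀ b ∈ T, a ≠ b → G.Adj a b) :
    (comN G S T).card ≤ 2 := by
  by_contra hcon
  obtain ⟨U, hU, hU3⟩ := Finset.exists_subset_card_eq (show 3 ≤ (comN G S T).card by omega)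
  let e := (Finset.equivFinOfCardEq hT).symm
  let z := (Finset.equivFinOfCardEq hU3).symm
  refine planar_no_three G hp (fun i => (e i : V)) ?_ (fun i => (z i : V)) ?_ ?_
  · intro i j hij
    exact hc _ (e i).2 _ (e j).2 (fun h => hij (e.injective (Subtype.ext h)))
  · intro i j hij
    exact z.injective (Subtype.ext hij)
  · intro i j
    have := hU (z i).2
    classical
    unfold comN at this
    rw [Finset.mem_filter] at this
    exact this.2 _ (e j).2

/-- Every plane 3-tree with positive vertex weights admits a
proportional box-contact representation: pairwise interior-disjoint axis-aligned
boxes, the box of `v` having volume `w v`, with two boxes sharing boundary of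
non-zero area iff the vertices are adjacent. -/
theorem plane_three_tree_proportional_box_contact
    {V : Type} [Fintype V] [DecidableEq V] (G : SimpleGraph V)
    (htree : IsThreeTree G) (hplanar : IsPlanar G)
    (w : V → ℝ) (hw : ∀ v, 0 < w v) :
    ∃ ρ : V → Box,
      (∀ v, (ρ v).volume = w v) ∧
      (∀ u v, u ≠ v → Disjoint (ρ u).interior (ρ v).interior) ∧
      (∀ u v, u ≠ v → (G.Adj u v ↔ Box.Contact (ρ u) (ρ v))) := by
  have hb : Build G (Finset.univ : Finset V) := by
    have := build_of_tree G _ V G (Function.Embedding.refl V) rfl (fun _ _ => Iff.rfl) htree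
    simpa using this
  obtain ⟨ρ, R, h⟩ := rep_of_build G (comN_le_two G hplanar) w hw _ hb (fun _ _ => 1)
    (fun _ _ => one_pos)
  have hcon : ∀ u v, G.Adj u v → (ρ u).Contact (ρ v) :=
    fun u v => h.con u (Finset.mem_univ _) v (Finset.mem_univ _)
  have hsep : ∀ u v, u ≠ v → ¬ G.Adj u v → (ρ u).Sep (ρ v) :=
    fun u v => h.sep u (Finset.mem_univ _) v (Finset.mem_univ _)
  refine ⟨ρ, fun v => h.vol v (Finset.mem_univ _), ?_, ?_⟩
  · intro u v huv
    by_cases ha : G.Adj u v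
    · exact (hcon u v ha).disjoint
    · exact (hsep u v huv ha).disjoint
  · intro u v huv
    refine ⟨hcon u v, fun hc => ?_⟩
    by_contra ha
    exact (hsep u v huv ha).not_contact hc
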